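/- Let n ≥ 2 be an integer. There exists ς > 0 such that for every multi-index η ∈ ℕⁿ (including η = 0), every finite Borel measure σ on ℝⁿ with compact support, every Borel measurable ν : ℝⁿ → ℝⁿ with ‖ν(y)‖ ≤ 1 for all y, every ψ ∈ L¹(σ), and every x ∈ ℝⁿ with dist(x, supp σ) ≥ 1, the partial derivative D^η of the double layer potential w[ψ] satisfies |D^η w[ψ](x)| ≤ n · ς^{|η|+1} · (|η|+1)! · ∫ |ψ| dσ. -/

import Mathlib

open MeasureTheory Metric Filter Topology

noncomputable section

/-- The `(n-1)`-dimensional Hausdorff measure of the unit sphere of `ℝⁿ`. -/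
def sphereArea (n : ℕ) : ℝ :=
  (MeasureTheory.Measure.hausdorffMeasure ((n : ℝ) - 1)
    (Metric.sphere (0 : EuclideanSpace ℝ (Fin n)) 1)).toReal

/-- The fundamental solution of the Laplace operator in `ℝⁿ`. -/
def fundSol (n : ℕ) (ξ : EuclideanSpace ℝ (Fin n)) : ℝ :=
  if n = 2 then (1 / (2 * Real.pi)) * Real.log ‖ξ‖
  else ‖ξ‖ ^ ((2 : ℝ) - n) / (((2 : ℝ) - n) * sphereArea n)

/-- The support of a measure: the smallest closed set whose complement is null. -/
def measSupport {E : Type*} [TopologicalSpace E] [MeasurableSpace E]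
    (σ : MeasureTheory.Measure E) : Set E :=
  ⋂₀ {C : Set E | IsClosed C ∧ σ Cᶜ = 0}

/-- Partial derivative in the `i`-th coordinate direction. -/
def pderivE {n : ℕ} (i : Fin n) (f : EuclideanSpace ℝ (Fin n) → ℝ) :
    EuclideanSpace ℝ (Fin n) → ℝ :=
  fun x => fderiv ℝ f x (EuclideanSpace.single i 1)

/-- Iterated partial derivative `D^η` associated with the multi-index `η`. -/
def mderiv {n : ℕ} (η : Fin n → ℕ) (f : EuclideanSpace ℝ (Fin n) → ℝ) :
    EuclideanSpace ℝ (Fin n) → ℝ :=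
  ((List.ofFn fun i : Fin n => (pderivE i)^[η i]).foldr (fun g h => g ∘ h) id) f

/-- `f` is harmonic on `U`: twice continuously differentiable on `U` with vanishing
Laplacian on `U`. -/
def HarmonicOnSet {n : ℕ} (f : EuclideanSpace ℝ (Fin n) → ℝ)
    (U : Set (EuclideanSpace ℝ (Fin n))) : Prop :=
  ContDiffOn ℝ 2 f U ∧ ∀ x ∈ U, (∑ i : Fin n, pderivE i (pderivE i f) x) = 0

/-- The closed set `measSupport σ` carries the whole measure. -/
theorem measure_compl_measSupport {E : Type*} [TopologicalSpace E] [SecondCountableTopology E]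
    [MeasurableSpace E] (σ : Measure E) : σ (measSupport σ)ᶜ = 0 := by
  rw [measSupport, Set.compl_sInter]
  obtain ⟨T, hT, hTS, hU⟩ := TopologicalSpace.isOpen_sUnion_countable
    (compl '' {C : Set E | IsClosed C ∧ σ Cᶜ = 0})
    (by rintro _ ⟨C, hC, rfl⟩; exact hC.1.isOpen_compl)
  rw [← hU, measure_sUnion_null_iff hT]
  intro s hs
  obtain ⟨C, hC, rfl⟩ := hTS hs
  exact hC.2

/-- A property stable under every partial derivative, up to a shift of its level by one, passes
to the derivative `D^η` with a shift by `|η|`. -/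
theorem mderiv_induction {n : ℕ} {P : ℕ → (EuclideanSpace ℝ (Fin n) → ℝ) → Prop}
    (hP : ∀ k f i, P k f → P (k + 1) (pderivE i f)) (η : Fin n → ℕ)
    {f : EuclideanSpace ℝ (Fin n) → ℝ} (hf : P 0 f) : P (∑ i, η i) (mderiv η f) := by
  have hiter : ∀ (i : Fin n) (a k : ℕ) (g : EuclideanSpace ℝ (Fin n) → ℝ), P k g →
      P (a + k) ((pderivE i)^[a] g) := by
    intro i a
    induction a with
    | zero => intro k g hg; simpa using hg
    | succ a ih =>
      intro k g hg
      rw [Function.iterate_succ_apply', Nat.add_right_comm]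
      exact hP _ _ i (ih k g hg)
  have hlist : ∀ l : List (Fin n), P (l.map η).sum
      (((l.map fun i => (pderivE i)^[η i]).foldr (fun g h => g ∘ h) id) f) := by
    intro l
    induction l with
    | nil => simpa using hf
    | cons i l ih => simpa using hiter i (η i) _ _ ih
  have := hlist (List.finRange n)
  rwa [← List.ofFn_eq_map, ← List.ofFn_eq_map, List.sum_ofFn] at this

/-- The kernel `ξ ↦ ξ^α ‖ξ‖^{-m}`. -/
def monomialKernel {n : ℕ} (α : Fin n → ℕ) (m : ℕ) (ξ : EuclideanSpace ℝ (Fin n)) : ℝ :=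
  (∏ i, ξ i ^ α i) * (‖ξ‖ ^ m)⁻¹

theorem measurable_monomialKernel {n : ℕ} (α : Fin n → ℕ) (m : ℕ) :
    Measurable (monomialKernel α m) := by
  unfold monomialKernel
  fun_prop

theorem contDiffOn_monomialKernel {n : ℕ} (α : Fin n → ℕ) (m : ℕ) :
    ContDiffOn ℝ 1 (monomialKernel α m) {0}ᶜ := by
  intro ξ hξ
  have hξ0 : ξ ≠ 0 := hξ
  refine ContDiffAt.contDiffWithinAt ?_
  unfold monomialKernel
  refine ContDiffAt.mul ?_ (((contDiffAt_norm ℝ hξ0).pow m).inv (by positivity))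
  fun_prop

theorem abs_monomialKernel_le_one {n : ℕ} {α : Fin n → ℕ} {m : ℕ} (hα : ∑ i, α i ≤ m)
    {ξ : EuclideanSpace ℝ (Fin n)} (hξ : 1 ≤ ‖ξ‖) : |monomialKernel α m ξ| ≤ 1 := by
  have h1 : ∏ i, |ξ i| ^ α i ≤ ‖ξ‖ ^ m := calc
    ∏ i, |ξ i| ^ α i ≤ ∏ i, ‖ξ‖ ^ α i := by
      gcongr with i
      exact PiLp.norm_apply_le ξ i
    _ = ‖ξ‖ ^ ∑ i, α i := Finset.prod_pow_eq_pow_sum _ _ _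
    _ ≤ ‖ξ‖ ^ m := pow_le_pow_right₀ hξ hα
  rw [monomialKernel, abs_mul, Finset.abs_prod, abs_inv, abs_pow, abs_norm]
  simp only [abs_pow]
  rw [← div_eq_mul_inv]
  exact div_le_one_of_le₀ h1 (by positivity)

theorem hasFDerivAt_norm_of_ne_zero {E : Type*} [NormedAddCommGroup E] [InnerProductSpace ℝ E]
    {ξ : E} (hξ : ξ ≠ 0) :
    HasFDerivAt (fun x : E => ‖x‖) (‖ξ‖⁻¹ • innerSL ℝ ξ) ξ := by
  have h := ((hasStrictFDerivAt_norm_sq ξ).hasFDerivAt).sqrt (by positivity)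
  simp only [Real.sqrt_sq (norm_nonneg _)] at h
  refine h.congr_fderiv ?_
  ext v
  simp
  field_simp

theorem pderivE_monomialKernel {n : ℕ} (α : Fin n → ℕ) (m : ℕ) (i : Fin n)
    {ξ : EuclideanSpace ℝ (Fin n)} (hξ : ξ ≠ 0) :
    pderivE i (monomialKernel α m) ξ =
      α i * monomialKernel (α - Pi.single i 1) m ξ -
        m * monomialKernel (α + Pi.single i 1) (m + 2) ξ := by
  have hprod : HasFDerivAt (fun x : EuclideanSpace ℝ (Fin n) => ∏ j, x j ^ α j)
      (∑ j, (∏ k ∈ Finset.univ.erase j, ξ k ^ α k) •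
        ((α j * ξ j ^ (α j - 1)) • EuclideanSpace.proj (𝕜 := ℝ) j)) ξ :=
    HasFDerivAt.finsetProd fun j _ => by
      simpa using
        ((EuclideanSpace.proj j : EuclideanSpace ℝ (Fin n) →L[ℝ] ℝ).hasFDerivAt (x := ξ)).pow (α j)
  have hnorm : HasFDerivAt (fun x : EuclideanSpace ℝ (Fin n) => (‖x‖ ^ m)⁻¹) _ ξ :=
    (hasDerivAt_inv (by positivity)).comp_hasFDerivAt ξ ((hasFDerivAt_norm_of_ne_zero hξ).pow m)
  have hfd : HasFDerivAt (monomialKernel α m) _ ξ := hprod.mul hnorm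
  have hsub : ∏ j, ξ j ^ (α - Pi.single i 1 : Fin n → ℕ) j =
      ξ i ^ (α i - 1) * ∏ k ∈ Finset.univ.erase i, ξ k ^ α k := by
    rw [← Finset.mul_prod_erase _ _ (Finset.mem_univ i)]
    congr 1
    · simp
    · refine Finset.prod_congr rfl fun k hk => ?_
      simp [Finset.ne_of_mem_erase hk]
  have hadd : ∏ j, ξ j ^ (α + Pi.single i 1 : Fin n → ℕ) j = (∏ j, ξ j ^ α j) * ξ i := by
    simp only [Pi.add_apply, pow_add, Finset.prod_mul_distrib]
    congr 1
    simp [Pi.single_apply]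
  have hne : ‖ξ‖ ≠ 0 := norm_ne_zero_iff.2 hξ
  rw [pderivE, hfd.fderiv, monomialKernel, monomialKernel, hsub, hadd]
  simp only [_root_.add_apply, _root_.smul_apply, _root_.sum_apply, innerSL_apply_apply,
    EuclideanSpace.inner_single_right, EuclideanSpace.coe_proj, PiLp.single_apply, smul_eq_mul,
    nsmul_eq_mul]
  rcases m with _ | m
  · simp
    ring
  · simp
    field_simp
    ring

theorem fderiv_fundSol {n : ℕ} : ∃ c : ℝ, ∀ ξ : EuclideanSpace ℝ (Fin n), ξ ≠ 0 →
    ∀ v, fderiv ℝ (fundSol n) ξ v =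
      c * ∑ j, v j * monomialKernel (Pi.single j 1) n ξ := by
  have hinner : ∀ ξ v : EuclideanSpace ℝ (Fin n),
      ∑ j, v j * monomialKernel (Pi.single j 1) n ξ = inner ℝ ξ v * (‖ξ‖ ^ n)⁻¹ := by
    intro ξ v
    simp only [monomialKernel, PiLp.inner_apply, Finset.sum_mul]
    refine Finset.sum_congr rfl fun j _ => ?_
    simp [Pi.single_apply]
    ring
  simp only [hinner]
  rcases eq_or_ne n 2 with rfl | h2
  · refine ⟨1 / (2 * Real.pi), fun ξ hξ v => ?_⟩
    have hne : ‖ξ‖ ≠ 0 := norm_ne_zero_iff.2 hξ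
    have h : HasFDerivAt (fundSol 2) _ ξ :=
      (((hasFDerivAt_norm_of_ne_zero hξ).log hne).const_mul
        (1 / (2 * Real.pi))).congr_of_eventuallyEq
        (.of_forall fun x => by simp [fundSol])
    rw [h.fderiv]
    simp
    field_simp
  · refine ⟨(sphereArea n)⁻¹, fun ξ hξ v => ?_⟩
    have hne : ‖ξ‖ ≠ 0 := norm_ne_zero_iff.2 hξ
    have h : HasFDerivAt (fundSol n) _ ξ :=
      (((hasFDerivAt_norm_of_ne_zero hξ).rpow_const (p := (2 : ℝ) - n) (.inl hne)).mul_const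
        (((2 : ℝ) - n) * sphereArea n)⁻¹).congr_of_eventuallyEq
        (.of_forall fun x => by simp [fundSol, h2, div_eq_mul_inv])
    have h2' : (2 : ℝ) - n ≠ 0 := sub_ne_zero.2 fun h => h2 (by exact_mod_cast h.symm)
    have hpow : ‖ξ‖ ^ ((2 : ℝ) - n - 1) = ‖ξ‖ * (‖ξ‖ ^ n)⁻¹ := by
      rw [show (2 : ℝ) - n - 1 = 1 - n by ring, Real.rpow_sub (by positivity), Real.rpow_one,
        Real.rpow_natCast, div_eq_mul_inv]
    rw [h.fderiv]
    simp [hpow]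
    field_simp

theorem exists_bound_comp_sub {E F : Type*} [NormedAddCommGroup E] [NormedAddCommGroup F]
    {K S : Set E} (hK : IsCompact K) (hS : IsCompact S)
    (hKS : Disjoint K S) {g : E → F} (hg : ContinuousOn g {0}ᶜ) :
    ∃ C, ∀ x ∈ K, ∀ y ∈ S, ‖g (x - y)‖ ≤ C := by
  obtain ⟨C, hC⟩ := (hK.prod hS).exists_bound_of_continuousOn
    (hg.comp (continuous_fst.sub continuous_snd).continuousOn fun p hp =>
      sub_ne_zero.2 (hKS.ne_of_mem hp.1 hp.2))
  exact ⟨C, fun x hx y hy => hC (x, y) ⟨hx, hy⟩⟩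

section Convolution

variable {E F : Type*} [NormedAddCommGroup E] [MeasurableSpace E] [BorelSpace E]
  [SecondCountableTopology E] [NormedAddCommGroup F] [NormedSpace ℝ F] {σ : Measure E} {S : Set E}
  {φ : E → ℝ} {z : E}

theorem integrable_smul_comp_sub (hS : IsCompact S) (hσ : σ Sᶜ = 0) (hφ : Integrable φ σ)
    (hz : z ∉ S) {g : E → F} (hgm : StronglyMeasurable g) (hg : ContinuousOn g {0}ᶜ) :
    Integrable (fun y => φ y • g (z - y)) σ := by
  obtain ⟨C, hC⟩ := exists_bound_comp_sub (isCompact_singleton (x := z)) hS (by simpa) hg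
  refine hφ.smul_bdd C
    (hgm.comp_measurable (measurable_const.sub measurable_id)).aestronglyMeasurable ?_
  filter_upwards [mem_ae_iff.2 hσ] with y hy using hC z rfl y hy

theorem hasFDerivAt_integral_mul_comp_sub [NormedSpace ℝ E] [FiniteDimensional ℝ E]
    (hS : IsCompact S) (hσ : σ Sᶜ = 0) (hφ : Integrable φ σ)
    (hz : z ∉ S) {g : E → ℝ} (hgm : Measurable g) (hg : ContDiffOn ℝ 1 g {0}ᶜ) :
    Integrable (fun y => φ y • fderiv ℝ g (z - y)) σ ∧
    HasFDerivAt (fun x => ∫ y, φ y * g (x - y) ∂σ) (∫ y, φ y • fderiv ℝ g (z - y) ∂σ) z := by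
  have hfd : ContinuousOn (fderiv ℝ g) {0}ᶜ :=
    hg.continuousOn_fderiv_of_isOpen isOpen_compl_singleton le_rfl
  have hfdm : StronglyMeasurable (fderiv ℝ g) := (measurable_fderiv ℝ g).stronglyMeasurable
  obtain ⟨ε, hε, hεS⟩ := nhds_basis_closedBall.mem_iff.1
    (hS.isClosed.isOpen_compl.mem_nhds hz)
  obtain ⟨C, hC⟩ := exists_bound_comp_sub (isCompact_closedBall z ε) hS
    (Set.subset_compl_iff_disjoint_right.1 hεS) hfd
  have hint := integrable_smul_comp_sub hS hσ hφ hz hfdm hfd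
  refine ⟨hint, hasFDerivAt_integral_of_dominated_of_fderiv_le
    (F' := fun x y => φ y • fderiv ℝ g (x - y)) (bound := fun y => |φ y| * C)
    (closedBall_mem_nhds z hε) (.of_forall fun x => ?_) ?_ hint.aestronglyMeasurable ?_
    (hφ.abs.mul_const C) ?_⟩
  · exact hφ.aestronglyMeasurable.mul
      (hgm.comp (measurable_const.sub measurable_id)).aestronglyMeasurable
  · simpa using integrable_smul_comp_sub hS hσ hφ hz hgm.stronglyMeasurable hg.continuousOn
  · filter_upwards [mem_ae_iff.2 hσ] with y hy x hx
    rw [norm_smul, Real.norm_eq_abs]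
    exact mul_le_mul_of_nonneg_left (hC x hx y hy) (abs_nonneg _)
  · filter_upwards [mem_ae_iff.2 hσ] with y hy x hx
    have hxy : x - y ≠ 0 := sub_ne_zero.2 fun h => hεS hx (h ▸ hy)
    have hd : HasFDerivAt g (fderiv ℝ g (x - y)) (x - y) :=
      ((hg.contDiffAt (isOpen_compl_singleton.mem_nhds hxy)).differentiableAt
        (by norm_num)).hasFDerivAt
    simpa [smul_eq_mul] using
      (hd.comp x ((hasFDerivAt_id x).sub_const y)).const_mul (φ y)

end Convolution

/-- The potential `z ↦ ∫ φ(y) (z - y)^α ‖z - y‖^{-m} dσ(y)`. -/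
def monomialPotential {n : ℕ} (σ : Measure (EuclideanSpace ℝ (Fin n)))
    (φ : EuclideanSpace ℝ (Fin n) → ℝ) (α : Fin n → ℕ) (m : ℕ) (z : EuclideanSpace ℝ (Fin n)) : ℝ :=
  ∫ y, φ y * monomialKernel α m (z - y) ∂σ

section Potential

variable {n : ℕ} {σ : Measure (EuclideanSpace ℝ (Fin n))} {S : Set (EuclideanSpace ℝ (Fin n))}
  {φ : EuclideanSpace ℝ (Fin n) → ℝ}

theorem integrable_mul_monomialKernel (hS : IsCompact S) (hσ : σ Sᶜ = 0) (hφ : Integrable φ σ)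
    (α : Fin n → ℕ) (m : ℕ) {z : EuclideanSpace ℝ (Fin n)} (hz : z ∉ S) :
    Integrable (fun y => φ y * monomialKernel α m (z - y)) σ :=
  integrable_smul_comp_sub hS hσ hφ hz (measurable_monomialKernel α m).stronglyMeasurable
    (contDiffOn_monomialKernel α m).continuousOn

theorem differentiableOn_monomialPotential (hS : IsCompact S) (hσ : σ Sᶜ = 0)
    (hφ : Integrable φ σ) (α : Fin n → ℕ) (m : ℕ) :
    DifferentiableOn ℝ (monomialPotential σ φ α m) Sᶜ := fun _ hz =>
  (hasFDerivAt_integral_mul_comp_sub hS hσ hφ hz (measurable_monomialKernel α m)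
    (contDiffOn_monomialKernel α m)).2.differentiableAt.differentiableWithinAt

theorem pderivE_monomialPotential (hS : IsCompact S) (hσ : σ Sᶜ = 0) (hφ : Integrable φ σ)
    (α : Fin n → ℕ) (m : ℕ) (i : Fin n) {z : EuclideanSpace ℝ (Fin n)} (hz : z ∉ S) :
    pderivE i (monomialPotential σ φ α m) z =
      α i * monomialPotential σ φ (α - Pi.single i 1) m z -
        m * monomialPotential σ φ (α + Pi.single i 1) (m + 2) z := by
  obtain ⟨hint, hd⟩ := hasFDerivAt_integral_mul_comp_sub hS hσ hφ hz
    (measurable_monomialKernel α m) (contDiffOn_monomialKernel α m)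
  have hd' : HasFDerivAt (monomialPotential σ φ α m) _ z := hd
  rw [pderivE, hd'.fderiv, ContinuousLinearMap.integral_apply hint]
  unfold monomialPotential
  rw [← integral_const_mul, ← integral_const_mul, ← integral_sub
    ((integrable_mul_monomialKernel hS hσ hφ _ _ hz).const_mul _)
    ((integrable_mul_monomialKernel hS hσ hφ _ _ hz).const_mul _)]
  refine integral_congr_ae ?_
  filter_upwards [mem_ae_iff.2 hσ] with y hy
  have h := pderivE_monomialKernel α m i (sub_ne_zero.2 fun h : z = y => hz (h ▸ hy))
  rw [pderivE] at h
  rw [_root_.smul_apply, smul_eq_mul, h]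
  ring

theorem abs_monomialPotential_le (hσ : σ Sᶜ = 0) (hφ : Integrable φ σ) {α : Fin n → ℕ} {m : ℕ}
    (hα : ∑ i, α i ≤ m) {z : EuclideanSpace ℝ (Fin n)} (hz : 1 ≤ infDist z S) :
    |monomialPotential σ φ α m z| ≤ ∫ y, |φ y| ∂σ := by
  rw [monomialPotential, ← Real.norm_eq_abs]
  refine norm_integral_le_of_norm_le hφ.abs ?_
  filter_upwards [mem_ae_iff.2 hσ] with y hy
  rw [norm_mul, Real.norm_eq_abs, Real.norm_eq_abs]
  refine mul_le_of_le_one_right (abs_nonneg _) (abs_monomialKernel_le_one hα ?_)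
  rw [← dist_eq_norm]
  exact hz.trans (infDist_le_dist_of_mem hy)

/-- `PotentialCombination σ S M k A f` says that on `Sᶜ` the function `f` is a linear combination,
with coefficients of total absolute value at most `A`, of monomial potentials of the shape
produced by `k` differentiations of `z ↦ ∫ φ(y) (z - y)_j ‖z - y‖^{-n} dσ(y)`, where the `L¹` norm
of each density `φ` is at most `M`. -/
inductive PotentialCombination {n : ℕ} (σ : Measure (EuclideanSpace ℝ (Fin n)))
    (S : Set (EuclideanSpace ℝ (Fin n))) (M : ℝ) (k : ℕ) :
    ℝ → (EuclideanSpace ℝ (Fin n) → ℝ) → Prop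
  | mono (φ : EuclideanSpace ℝ (Fin n) → ℝ) (α : Fin n → ℕ) (m : ℕ) (hφ : Integrable φ σ)
      (hM : ∫ y, |φ y| ∂σ ≤ M) (hα : ∑ i, α i ≤ k + 1) (hαm : ∑ i, α i ≤ m) (hm : m ≤ n + 2 * k) :
      PotentialCombination σ S M k 1 (monomialPotential σ φ α m)
  | smul (c : ℝ) {A : ℝ} {f : EuclideanSpace ℝ (Fin n) → ℝ}
      (hf : PotentialCombination σ S M k A f) : PotentialCombination σ S M k (|c| * A) (c • f)
  | add {A B : ℝ} {f g : EuclideanSpace ℝ (Fin n) → ℝ} (hf : PotentialCombination σ S M k A f)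
      (hg : PotentialCombination σ S M k B g) : PotentialCombination σ S M k (A + B) (f + g)
  | congr {A B : ℝ} {f g : EuclideanSpace ℝ (Fin n) → ℝ} (hf : PotentialCombination σ S M k A f)
      (hAB : A ≤ B) (hfg : Set.EqOn f g Sᶜ) : PotentialCombination σ S M k B g

namespace PotentialCombination

variable {M A : ℝ} {k : ℕ} {f : EuclideanSpace ℝ (Fin n) → ℝ}

theorem differentiableOn (hS : IsCompact S) (hσ : σ Sᶜ = 0)
    (hf : PotentialCombination σ S M k A f) : DifferentiableOn ℝ f Sᶜ := by
  induction hf with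
  | mono φ α m hφ => exact differentiableOn_monomialPotential hS hσ hφ α m
  | smul c _ ih => exact ih.const_smul c
  | add _ _ ihf ihg => exact ihf.add ihg
  | congr _ _ hfg ih => exact ih.congr hfg.symm

theorem abs_le (hσ : σ Sᶜ = 0) (hf : PotentialCombination σ S M k A f)
    {z : EuclideanSpace ℝ (Fin n)} (hz : 1 ≤ infDist z S) : |f z| ≤ A * M := by
  have hM : 0 ≤ M := by
    induction hf with
    | mono φ α m hφ hM => exact (integral_nonneg fun _ => abs_nonneg _).trans hM
    | smul _ _ ih | congr _ _ _ ih | add _ _ ih => exact ih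
  have hzS : z ∈ Sᶜ := fun h => by linarith [infDist_zero_of_mem h]
  induction hf with
  | mono φ α m hφ hM _ hαm =>
    rw [one_mul]
    exact (abs_monomialPotential_le hσ hφ hαm hz).trans hM
  | smul c _ ih =>
    rw [Pi.smul_apply, smul_eq_mul, abs_mul, mul_assoc]
    exact mul_le_mul_of_nonneg_left ih (abs_nonneg c)
  | add _ _ ihf ihg =>
    rw [add_mul]
    exact (abs_add_le _ _).trans (add_le_add ihf ihg)
  | congr _ hAB hfg ih =>
    rw [← hfg hzS]
    exact ih.trans (mul_le_mul_of_nonneg_right hAB hM)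

theorem pderivE (hS : IsCompact S) (hσ : σ Sᶜ = 0) (i : Fin n)
    (hf : PotentialCombination σ S M k A f) :
    PotentialCombination σ S M (k + 1) ((n + 3) * (k + 1) * A) (pderivE i f) := by
  have hat : ∀ {B : ℝ} {g : EuclideanSpace ℝ (Fin n) → ℝ} {z : EuclideanSpace ℝ (Fin n)},
      PotentialCombination σ S M k B g → z ∈ Sᶜ → DifferentiableAt ℝ g z :=
    fun hg hz => (hg.differentiableOn hS hσ).differentiableAt
      (hS.isClosed.isOpen_compl.mem_nhds hz)
  induction hf with
  | mono φ α m hφ hM hα hαm hm =>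
    have hsub : ∑ j, (α - Pi.single i 1 : Fin n → ℕ) j ≤ ∑ j, α j :=
      Finset.sum_le_sum fun j _ => Nat.sub_le _ _
    have hadd : ∑ j, (α + Pi.single i 1 : Fin n → ℕ) j = ∑ j, α j + 1 := by
      simp [Finset.sum_add_distrib]
    refine ((smul (α i) (mono φ (α - Pi.single i 1) m hφ hM (by omega) (by omega) (by omega))).add
      (smul (-m) (mono φ (α + Pi.single i 1) (m + 2) hφ hM (by omega) (by omega) (by omega)))).congr
        ?_ ?_
    · have hi : α i ≤ k + 1 :=
        (Finset.single_le_sum (fun j _ => Nat.zero_le (α j)) (Finset.mem_univ i)).trans hα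
      have : α i + m ≤ (n + 3) * (k + 1) := by nlinarith
      simp only [abs_neg, Nat.abs_cast, mul_one]
      exact_mod_cast this
    · intro z hz
      rw [pderivE_monomialPotential hS hσ hφ α m i hz]
      simp
      ring
  | @smul c A f hf ih =>
    refine (ih.smul c).congr (by linarith) fun z hz => ?_
    simp [_root_.pderivE, fderiv_const_smul (hat hf hz)]
  | add hf hg ihf ihg =>
    refine (ihf.add ihg).congr (by linarith) fun z hz => ?_
    simp [_root_.pderivE, fderiv_add (hat hf hz) (hat hg hz)]
  | congr hf hAB hfg ih =>
    refine ih.congr (by gcongr) fun z hz => ?_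
    have hev := hfg.eventuallyEq_of_mem (hS.isClosed.isOpen_compl.mem_nhds hz)
    simp [_root_.pderivE, hev.fderiv_eq]

theorem mderiv (hS : IsCompact S) (hσ : σ Sᶜ = 0) (η : Fin n → ℕ)
    (hf : PotentialCombination σ S M 0 A f) :
    PotentialCombination σ S M (∑ i, η i) ((n + 3) ^ (∑ i, η i) * (∑ i, η i).factorial * A)
      (mderiv η f) := by
  refine mderiv_induction (P := fun k g =>
    PotentialCombination σ S M k ((n + 3) ^ k * k.factorial * A) g) (fun k g i hg => ?_) η
      (by simpa)
  refine (hg.pderivE hS hσ i).congr (le_of_eq ?_) fun _ _ => rfl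
  rw [Nat.factorial_succ]
  push_cast
  ring

theorem sum {ι : Type*} {s : Finset ι} (hs : s.Nonempty) {g : ι → EuclideanSpace ℝ (Fin n) → ℝ}
    (hg : ∀ j ∈ s, PotentialCombination σ S M k A (g j)) :
    PotentialCombination σ S M k (s.card * A) (∑ j ∈ s, g j) := by
  induction hs using Finset.Nonempty.cons_induction with
  | singleton a => simpa using hg a
  | cons a s ha hs ih =>
    rw [Finset.sum_cons, Finset.card_cons]
    refine ((hg a (by simp)).add (ih fun j hj => hg j (by simp [hj]))).congr (le_of_eq ?_)
      fun _ _ => rfl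
    push_cast
    ring

end PotentialCombination

end Potential

/-- uniform bounds on all partial derivatives of the double layer potential
at points whose distance from the support of the measure is at least one. -/
theorem doubleLayer_deriv_bound
    (n : ℕ) (hn : 2 ≤ n) :
    ∃ ς : ℝ, 0 < ς ∧
      ∀ η : Fin n → ℕ,
      ∀ σ : Measure (EuclideanSpace ℝ (Fin n)), IsFiniteMeasure σ →
        IsCompact (measSupport σ) →
      ∀ ν : EuclideanSpace ℝ (Fin n) → EuclideanSpace ℝ (Fin n),
        Measurable ν → (∀ y, ‖ν y‖ ≤ 1) →
      ∀ ψ : EuclideanSpace ℝ (Fin n) → ℝ, Integrable ψ σ →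
      ∀ x : EuclideanSpace ℝ (Fin n), 1 ≤ Metric.infDist x (measSupport σ) →
        |mderiv η
            (fun z => -∫ y, ψ y * fderiv ℝ (fundSol n) (z - y) (ν y) ∂σ) x| ≤
          (n : ℝ) * ς ^ ((∑ i, η i) + 1) * (Nat.factorial ((∑ i, η i) + 1) : ℝ) *
            ∫ y, |ψ y| ∂σ := by
  obtain ⟨c, hc⟩ := fderiv_fundSol (n := n)
  refine ⟨(|c| + 1) * (n + 3), by positivity, ?_⟩
  intro η σ _ hS ν hν hν1 ψ hψ x hx
  have hσ := measure_compl_measSupport σ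
  set S := measSupport σ
  set M := ∫ y, |ψ y| ∂σ
  have hM0 : 0 ≤ M := integral_nonneg fun _ => abs_nonneg _
  have hνj : ∀ j y, |ν y j| ≤ 1 := fun j y => (PiLp.norm_apply_le (ν y) j).trans (hν1 y)
  have hφ : ∀ j, Integrable (fun y => ψ y * ν y j) σ := fun j =>
    hψ.mul_bdd (c := 1) (by fun_prop) (.of_forall (hνj j))
  have hφM : ∀ j, ∫ y, |ψ y * ν y j| ∂σ ≤ M := fun j =>
    integral_mono (hφ j).abs hψ.abs fun y => by
      simpa [abs_mul] using mul_le_of_le_one_right (abs_nonneg (ψ y)) (hνj j y)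
  have hsum := (PotentialCombination.sum (S := S) (k := 0)
    (s := Finset.univ) ⟨(⟨0, by omega⟩ : Fin n), Finset.mem_univ _⟩
    fun j _ => .mono _ (Pi.single j 1) n (hφ j) (hφM j) (by simp) (by simp; omega) (by omega))
  have hw : PotentialCombination σ S M 0 (|c| * n)
      (fun z => -∫ y, ψ y * fderiv ℝ (fundSol n) (z - y) (ν y) ∂σ) := by
    refine (hsum.smul (-c)).congr (by simp) fun z hz => ?_
    have hint := fun j => integrable_mul_monomialKernel hS hσ (hφ j) (Pi.single j 1) n hz
    simp only [Pi.smul_apply, Finset.sum_apply, monomialPotential, smul_eq_mul, neg_mul]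
    rw [← integral_finsetSum _ fun j _ => hint j, ← integral_const_mul, neg_inj]
    refine integral_congr_ae ?_
    filter_upwards [mem_ae_iff.2 hσ] with y hy
    rw [hc _ (sub_ne_zero.2 fun h : z = y => hz (h ▸ hy)), mul_left_comm, Finset.mul_sum (a := ψ y)]
    simp only [mul_assoc]
  refine ((hw.mderiv hS hσ η).abs_le hσ hx).trans ?_
  refine mul_le_mul_of_nonneg_right ?_ hM0
  set k := ∑ i, η i
  have hc1 : |c| ≤ (|c| + 1) ^ (k + 1) :=
    (le_add_of_nonneg_right zero_le_one).trans (le_self_pow₀ (by simp) (by simp))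
  have hn1 : ((n : ℝ) + 3) ^ k ≤ (n + 3) ^ (k + 1) :=
    pow_le_pow_right₀ (by linarith [(Nat.cast_nonneg n : (0 : ℝ) ≤ n)]) (by simp)
  have hk : (k.factorial : ℝ) ≤ (k + 1).factorial := by
    exact_mod_cast Nat.factorial_le (by simp)
  calc ((n : ℝ) + 3) ^ k * k.factorial * (|c| * n)
      ≤ (n + 3) ^ (k + 1) * (k + 1).factorial * ((|c| + 1) ^ (k + 1) * n) := by gcongr
    _ = n * ((|c| + 1) * (n + 3)) ^ (k + 1) * (k + 1).factorial := by
      rw [mul_pow]; ring
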